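/- Let A = (Q, δ, I, F) be a BA, ≼ a direct simulation on A, and # : Q → ℕ a function with #(p) = #(q) iff p and q lie in the same SCC of A and #(p) ≤ #(q) whenever q is reachable from p. For w ∈ Σ^ω, there exists an accepting trace over w matching the subset sequence ρ_w if and only if there exists an accepting trace over w matching the pruned sequence pr(ρ_w). -/

import Mathlib

attribute [local instance] Classical.propDecidable

universe u v w y

/-- Emerson–Lei acceptance conditions over colours `γ`. -/
inductive EL (γ : Type u) : Type u
  | inf : γ → EL γ
  | fin : γ → EL γ
  | conj : EL γ → EL γ → EL γ
  | disj : EL γ → EL γ → EL γ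

/-- Satisfaction of an Emerson–Lei condition by a set `M` of colours. -/
def EL.sat {γ : Type u} (M : Set γ) : EL γ → Prop
  | .inf c => c ∈ M
  | .fin c => c ∉ M
  | .conj φ ψ => φ.sat M ∧ ψ.sat M
  | .disj φ ψ => φ.sat M ∨ ψ.sat M

/-- Renaming of colours in an Emerson–Lei condition. -/
def EL.map {γ : Type u} {γ' : Type v} (f : γ → γ') : EL γ → EL γ'
  | .inf c => .inf (f c)
  | .fin c => .fin (f c)
  | .conj φ ψ => .conj (φ.map f) (ψ.map f)
  | .disj φ ψ => .disj (φ.map f) (ψ.map f)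

/-- A (transition-based) Büchi automaton over alphabet `A` with states `Q`. -/
structure BA (Q : Type u) (A : Type v) where
  delta : Set (Q × A × Q)
  init : Set Q
  F : Set (Q × A × Q)
  F_sub : F ⊆ delta

namespace BA

variable {Q : Type u} {A : Type v}

/-- `δ(S, a)`. -/
def deltaSet (M : BA Q A) (S : Set Q) (a : A) : Set Q :=
  {q | ∃ p ∈ S, (p, a, q) ∈ M.delta}

/-- `δ_F(S, a)`. -/
def deltaF (M : BA Q A) (S : Set Q) (a : A) : Set Q :=
  {q | ∃ p ∈ S, (p, a, q) ∈ M.F}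

/-- `δ(S, u)` for a finite word `u`. -/
def deltaWord (M : BA Q A) (S : Set Q) : List A → Set Q
  | [] => S
  | a :: u => M.deltaWord (M.deltaSet S a) u

/-- A run of the BA on an infinite word. -/
def IsRun (M : BA Q A) (w : ℕ → A) (ρ : ℕ → Q) : Prop :=
  ρ 0 ∈ M.init ∧ ∀ i, (ρ i, w i, ρ (i + 1)) ∈ M.delta

/-- An accepting run of the BA on an infinite word. -/
def AccRun (M : BA Q A) (w : ℕ → A) (ρ : ℕ → Q) : Prop :=
  M.IsRun w ρ ∧ {i | (ρ i, w i, ρ (i + 1)) ∈ M.F}.Infinite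

/-- The language of the BA. -/
def lang (M : BA Q A) : Set (ℕ → A) := {w | ∃ ρ, M.AccRun w ρ}

/-- Completeness of a BA. -/
def Complete (M : BA Q A) : Prop :=
  M.init.Nonempty ∧ ∀ q a, ∃ q', (q, a, q') ∈ M.delta

/-- One transition step (over some symbol). -/
def Step (M : BA Q A) (p q : Q) : Prop := ∃ a, (p, a, q) ∈ M.delta

/-- Reachability. -/
def Reach (M : BA Q A) : Q → Q → Prop := Relation.ReflTransGen M.Step

/-- Mutual reachability, i.e., lying in the same SCC. -/
def SameSCC (M : BA Q A) (p q : Q) : Prop := M.Reach p q ∧ M.Reach q p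

/-- A strongly connected component: a maximal nonempty set of pairwise
mutually reachable states. -/
def IsSCC (M : BA Q A) (C : Set Q) : Prop :=
  C.Nonempty ∧ (∀ p ∈ C, ∀ q ∈ C, M.Reach p q) ∧
    ∀ D, C ⊆ D → (∀ p ∈ D, ∀ q ∈ D, M.Reach p q) → D ⊆ C

/-- An accepting SCC: one containing an accepting transition with both
endpoints in it. -/
def IsAccSCC (M : BA Q A) (C : Set Q) : Prop :=
  M.IsSCC C ∧ ∃ p ∈ C, ∃ a, ∃ q ∈ C, (p, a, q) ∈ M.F

/-- `δ_SCC(S, a)`: restriction of `δ` to transitions staying in one SCC. -/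
def deltaSCC (M : BA Q A) (S : Set Q) (a : A) : Set Q :=
  {q | ∃ p ∈ S, (p, a, q) ∈ M.delta ∧ M.SameSCC p q}

/-- A cycle of length `k > 0` lying inside the set `C`. -/
def IsCycleIn (M : BA Q A) (C : Set Q) (k : ℕ) (ρ : ℕ → Q) (σ : ℕ → A) : Prop :=
  0 < k ∧ ρ 0 = ρ k ∧ ∀ i < k, ρ i ∈ C ∧ (ρ i, σ i, ρ (i + 1)) ∈ M.delta

/-- `C` is inherently weak: every cycle inside `C` contains an accepting
transition, or no cycle inside `C` contains one. -/
def InherentlyWeak (M : BA Q A) (C : Set Q) : Prop :=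
  (∀ k ρ σ, M.IsCycleIn C k ρ σ → ∃ i < k, (ρ i, σ i, ρ (i + 1)) ∈ M.F) ∨
  (∀ k ρ σ, M.IsCycleIn C k ρ σ → ∀ i < k, (ρ i, σ i, ρ (i + 1)) ∉ M.F)

/-- `C` is a deterministic SCC. -/
def DetSCC (M : BA Q A) (C : Set Q) : Prop :=
  ∀ q ∈ C, ∀ a : A, (M.deltaSet {q} a ∩ C).Subsingleton

/-- A partition block: a nonempty union of accepting SCCs. -/
def IsPartitionBlock (M : BA Q A) (P : Set Q) : Prop :=
  P.Nonempty ∧ ∃ Cs : Set (Set Q), (∀ C ∈ Cs, M.IsAccSCC C) ∧ P = ⋃₀ Cs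

/-- `A_P`: accepting transitions restricted to those between states of `P`. -/
def restrict (M : BA Q A) (P : Set Q) : BA Q A where
  delta := M.delta
  init := M.init
  F := M.F ∩ {t | t.1 ∈ P ∧ t.2.2 ∈ P}
  F_sub := fun _ ht => M.F_sub ht.1

end BA

/-- A partitioning of a BA: pairwise disjoint partition blocks containing
all accepting SCCs. -/
def IsPartitioning {Q : Type u} {A : Type v} {n : ℕ} (M : BA Q A)
    (P : Fin n → Set Q) : Prop :=
  (∀ i, M.IsPartitionBlock (P i)) ∧
  (Pairwise fun i j => Disjoint (P i) (P j)) ∧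
  ∀ C, M.IsAccSCC C → ∃ i, C ⊆ P i

/-- A transition-based Emerson–Lei automaton; transitions carry sets of
colours. -/
structure TELA (Q : Type u) (A : Type v) (γ : Type w) where
  trans : Set (Q × A × Set γ × Q)
  init : Set Q
  acc : EL γ

namespace TELA

variable {Q : Type u} {A : Type v} {γ : Type w}

/-- A run of the TELA (state sequence together with emitted colour sets). -/
def IsRun (T : TELA Q A γ) (w : ℕ → A) (ρ : ℕ → Q) (κ : ℕ → Set γ) : Prop :=
  ρ 0 ∈ T.init ∧ ∀ i, (ρ i, w i, κ i, ρ (i + 1)) ∈ T.trans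

/-- The union of colour sets of transitions occurring infinitely often. -/
def infCols (w : ℕ → A) (ρ : ℕ → Q) (κ : ℕ → Set γ) : Set γ :=
  {c | ∃ t : Q × A × Set γ × Q,
    {i | (ρ i, w i, κ i, ρ (i + 1)) = t}.Infinite ∧ c ∈ t.2.2.1}

/-- An accepting run of the TELA. -/
def AccRun (T : TELA Q A γ) (w : ℕ → A) (ρ : ℕ → Q) (κ : ℕ → Set γ) : Prop :=
  T.IsRun w ρ κ ∧ EL.sat (infCols w ρ κ) T.acc

/-- The language of the TELA. -/
def lang (T : TELA Q A γ) : Set (ℕ → A) := {w | ∃ ρ κ, T.AccRun w ρ κ}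

end TELA

/-- A partial complementation instance for a partition block. -/
structure PartialAlg (Q : Type u) (A : Type v) (T : Type w) (γ : Type y) where
  init : Set T
  succ : Set Q → T → A → Set (T × Set γ)
  acc : EL γ

/-- `ModCompl` for a single partial complementation instance. -/
def ModCompl1 {Q : Type u} {A : Type v} {T : Type w} {γ : Type y}
    (M : BA Q A) (alg : PartialAlg Q A T γ) : TELA (Set Q × T) A γ where
  init := {x | x.1 = M.init ∧ x.2 ∈ alg.init}
  trans := {x | ∃ H m a m' α, (m', α) ∈ alg.succ H m a ∧
    x = ((H, m), a, α, (M.deltaSet H a, m'))}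
  acc := alg.acc

/-- Conjunction of a nonempty family of Emerson–Lei conditions. -/
def ELbigAnd {γ : Type u} {n : ℕ} (f : Fin (n + 1) → EL γ) : EL γ :=
  List.foldl EL.conj (f 0) (List.ofFn fun i : Fin n => f i.succ)

/-- The synchronous modular complementation `ModCompl` for several partial
complementation instances; colours are renumbered via `Sigma.mk`. -/
def ModComplN {Q : Type u} {A : Type v} {n : ℕ} {T : Fin (n + 1) → Type w}
    {γ : Fin (n + 1) → Type y} (M : BA Q A)
    (alg : ∀ i, PartialAlg Q A (T i) (γ i)) :
    TELA (Set Q × (∀ i, T i)) A (Σ i, γ i) where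
  init := {x | x.1 = M.init ∧ ∀ i, x.2 i ∈ (alg i).init}
  trans := {x | ∃ (H : Set Q) (m : ∀ i, T i) (a : A) (m' : ∀ i, T i)
      (α : ∀ i, Set (γ i)),
    (∀ i, (m' i, α i) ∈ (alg i).succ H (m i) a) ∧
    x = ((H, m), a, {c : Σ i, γ i | c.2 ∈ α c.1}, (M.deltaSet H a, m'))}
  acc := ELbigAnd fun i => ((alg i).acc).map (Sigma.mk i)

/-- A partial round-robin complementation instance. -/
structure RRAlg (Q : Type u) (A : Type v) (Tt Ta : Type w) (γ : Type y) where
  init : Set Tt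
  succT : Set Q → Tt → A → Set (Tt × Set γ)
  succA : Set Q → Ta → A → Set ((Tt ⊕ Ta) × Set γ)
  lift : Tt → Set Ta
  acc : EL γ

/-- The flattening `algunion` of a partial round-robin instance. -/
def RRAlg.flatten {Q : Type u} {A : Type v} {Tt Ta : Type w} {γ : Type y}
    (R : RRAlg Q A Tt Ta γ) : PartialAlg Q A (Tt ⊕ Ta) γ where
  init := Sum.inl '' R.init
  succ := fun H m a =>
    match m with
    | Sum.inr mA => R.succA H mA a
    | Sum.inl mT =>
        {x | ∃ p ∈ R.succT H mT a, x = (Sum.inl p.1, p.2)} ∪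
        {x | ∃ p ∈ R.succT H mT a, ∃ m'' ∈ R.lift p.1, x = (Sum.inr m'', p.2)}
  acc := R.acc

/-- Consistency (conditions (C1)–(C3)) of a partial round-robin instance with
respect to a BA `B`. -/
def RRConsistent {Q : Type u} {A : Type v} {Tt Ta : Type w} {γ : Type y}
    (B : BA Q A) (R : RRAlg Q A Tt Ta γ) : Prop :=
  (∀ w ∈ (ModCompl1 B R.flatten).lang, ∃ ρ κ,
      (ModCompl1 B R.flatten).AccRun w ρ κ ∧
      {j | (ρ j).2.isRight = true ∧ ¬ (ρ (j + 1)).2.isRight = true}.Infinite) ∧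
  (∀ w ρ κ, (ModCompl1 B R.flatten).AccRun w ρ κ → ∀ i : ℕ,
      (i = 0 ∨ (ρ (i - 1)).2.isLeft = true) →
      ((∃ ρ' κ', (ModCompl1 B R.flatten).AccRun w ρ' κ' ∧
          (∀ j < i, ρ' j = ρ j) ∧ (ρ' i).2.isLeft = true) ∧
       (∃ ρ'' κ'', (ModCompl1 B R.flatten).AccRun w ρ'' κ'' ∧
          (∀ j < i, ρ'' j = ρ j) ∧ (ρ'' i).2.isRight = true))) ∧
  (∀ w ρ κ, (ModCompl1 B R.flatten).IsRun w ρ κ →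
      {j | (ρ j).2.isRight = true ∧ ¬ (ρ (j + 1)).2.isRight = true}.Infinite →
      (ModCompl1 B R.flatten).AccRun w ρ κ)

/-- A direct simulation on a BA. -/
def DirectSim {Q A : Type} (M : BA Q A) (r : Q → Q → Prop) : Prop :=
  Reflexive r ∧ Transitive r ∧
  ∀ p q, r p q → ∀ a p', (p, a, p') ∈ M.delta →
    ∃ q', (q, a, q') ∈ M.delta ∧ r p' q' ∧ ((p, a, p') ∈ M.F → (q, a, q') ∈ M.F)

/-- Pruning of a set of states w.r.t. the relation `⊑` (given as `sq`). -/
def pr {Q : Type} (sq : Q → Q → Prop) (S : Set Q) : Set Q :=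
  {p | p ∈ S ∧ ¬ ∃ q ∈ S, sq p q}

/-- The subset sequence `ρ_w`. -/
def subsetSeq {Q A : Type} (M : BA Q A) (w : ℕ → A) : ℕ → Set Q
  | 0 => M.init
  | i + 1 => M.deltaSet (subsetSeq M w i) (w i)

/-- The pruned subset sequence `pr(ρ_w)`. -/
def prunedSeq {Q A : Type} (M : BA Q A) (sq : Q → Q → Prop) (w : ℕ → A) :
    ℕ → Set Q
  | 0 => pr sq M.init
  | i + 1 => pr sq (M.deltaSet (prunedSeq M sq w i) (w i))

/-- An accepting trace over `w` matching the sequence `T` of subsets. -/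
def AccTraceMatching {Q A : Type} (M : BA Q A) (w : ℕ → A) (T : ℕ → Set Q)
    (π : ℕ → Q) : Prop :=
  (∀ i, π i ∈ T i) ∧ (∀ i, (π i, w i, π (i + 1)) ∈ M.delta) ∧
  {i | (π i, w i, π (i + 1)) ∈ M.F}.Infinite

/-- In a finite type, every element of `S` is kept by pruning or is strictly below a kept one. -/
theorem exists_mem_pr {Q : Type} [Finite Q] {r : Q → Q → Prop}
    (hr : ∀ ⦃a b c⦄, r a b → r b c → r a c) (h : Q → ℕ) {S : Set Q} {p : Q} (hp : p ∈ S) :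
    ∃ q ∈ pr (fun p q => r p q ∧ h p < h q) S, q = p ∨ (r p q ∧ h p < h q) := by
  by_cases hk : p ∈ pr (fun p q => r p q ∧ h p < h q) S
  · exact ⟨p, hk, Or.inl rfl⟩
  have hne : {q | q ∈ S ∧ r p q ∧ h p < h q}.Nonempty := by
    by_contra hcon
    exact hk ⟨hp, fun ⟨q, hq, hpq⟩ => hcon ⟨q, hq, hpq⟩⟩
  obtain ⟨q, ⟨hqS, hrq, hlt⟩, hmax⟩ :=
    Set.exists_max_image {q | q ∈ S ∧ r p q ∧ h p < h q} h (Set.toFinite _) hne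
  refine ⟨q, ⟨hqS, ?_⟩, Or.inr ⟨hrq, hlt⟩⟩
  rintro ⟨t, htS, hqt, hht⟩
  exact absurd (hmax t ⟨htS, hr hrq hqt, hlt.trans hht⟩) (not_le.mpr hht)

theorem prunedSeq_subset_subsetSeq {Q A : Type} (M : BA Q A) (sq : Q → Q → Prop) (w : ℕ → A)
    (i : ℕ) : prunedSeq M sq w i ⊆ subsetSeq M w i := by
  induction i with
  | zero => exact fun _ hp => hp.1
  | succ i ih =>
    rintro q ⟨⟨p, hp, hpq⟩, -⟩
    exact ⟨p, ih hp, hpq⟩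

/-- Every state of the pruned sequence is the end of a finite trace matching it. -/
theorem exists_prefix_prunedSeq {Q A : Type} (M : BA Q A) (sq : Q → Q → Prop) (w : ℕ → A)
    (k : ℕ) : ∀ p ∈ prunedSeq M sq w k, ∃ f : ℕ → Q, f k = p ∧
      (∀ i ≤ k, f i ∈ prunedSeq M sq w i) ∧ ∀ i < k, (f i, w i, f (i + 1)) ∈ M.delta := by
  induction k with
  | zero =>
    intro p hp
    refine ⟨fun _ => p, rfl, fun i hi => ?_, fun i hi => absurd hi (Nat.not_lt_zero i)⟩
    obtain rfl := Nat.le_zero.mp hi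
    exact hp
  | succ k ih =>
    intro q hq
    obtain ⟨p, hp, hpq⟩ := hq.1
    obtain ⟨f, hfk, hmem, hstep⟩ := ih p hp
    refine ⟨Function.update f (k + 1) q, Function.update_self .., fun i hi => ?_, fun i hi => ?_⟩
    · rcases hi.eq_or_lt with rfl | hlt
      · rwa [Function.update_self]
      · rw [Function.update_of_ne hlt.ne]
        exact hmem i (Nat.le_of_lt_succ hlt)
    · rw [Function.update_of_ne hi.ne]
      rcases (Nat.le_of_lt_succ hi).eq_or_lt with rfl | hlt
      · rwa [Function.update_self, hfk]
      · rw [Function.update_of_ne (by omega)]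
        exact hstep i hlt

/-- A trace step can be followed in the pruned sequence from a simulating state, either by a
transition that preserves acceptance or by a jump that strictly increases `h`. -/
theorem exists_next_prunedSeq {Q A : Type} [Finite Q] {M : BA Q A} {r : Q → Q → Prop}
    (hr : DirectSim M r) {h : Q → ℕ} (hmono : ∀ p q, M.Reach p q → h p ≤ h q) {w : ℕ → A}
    {i : ℕ} {p p' s : Q} (hp : (p, w i, p') ∈ M.delta)
    (hs : s ∈ prunedSeq M (fun p q => r p q ∧ h p < h q) w i) (hps : r p s) :
    ∃ s' ∈ prunedSeq M (fun p q => r p q ∧ h p < h q) w (i + 1), r p' s' ∧ h s ≤ h s' ∧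
      (h s = h s' → (s, w i, s') ∈ M.delta ∧
        ((p, w i, p') ∈ M.F → (s, w i, s') ∈ M.F)) := by
  obtain ⟨t, hst, hpt, hF⟩ := hr.2.2 p s hps (w i) p' hp
  have hle : h s ≤ h t := hmono s t (Relation.ReflTransGen.single ⟨w i, hst⟩)
  obtain ⟨q, hq, rfl | ⟨htq, hlt⟩⟩ := exists_mem_pr hr.2.1 h
    (show t ∈ M.deltaSet (prunedSeq M (fun p q => r p q ∧ h p < h q) w i) (w i) from ⟨s, hs, hst⟩)
  · exact ⟨q, hq, hpt, hle, fun _ => ⟨hst, hF⟩⟩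
  · exact ⟨q, hq, hr.2.1 hpt htq, by omega, fun _ => by omega⟩

/-- A monotone sequence of naturals with bounded values is eventually constant. -/
theorem Monotone.exists_forall_ge_eq_of_bddAbove {f : ℕ → ℕ} (hf : Monotone f)
    (hb : BddAbove (Set.range f)) : ∃ k, ∀ i ≥ k, f i = f k := by
  obtain ⟨k, hk⟩ := Nat.sSup_mem (Set.range_nonempty f) hb
  exact ⟨k, fun i hi => le_antisymm (hk ▸ le_csSup hb ⟨i, rfl⟩) (hf hi)⟩

theorem statement11 {Q A : Type} [Fintype Q] [Fintype A] [Nonempty A]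
    (M : BA Q A) (r : Q → Q → Prop) (hr : DirectSim M r)
    (h : Q → ℕ) (hsame : ∀ p q, h p = h q ↔ M.SameSCC p q)
    (hmono : ∀ p q, M.Reach p q → h p ≤ h q) (w : ℕ → A) :
    (∃ π, AccTraceMatching M w (subsetSeq M w) π) ↔
    (∃ π, AccTraceMatching M w
      (prunedSeq M (fun p q => r p q ∧ h p < h q) w) π) := by
  constructor
  · rintro ⟨π, hπ, hstep, hinf⟩
    set B := prunedSeq M (fun p q => r p q ∧ h p < h q) w
    have hzero : ∃ s ∈ B 0, r (π 0) s := by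
      obtain ⟨q, hq, rfl | ⟨hrq, -⟩⟩ := exists_mem_pr hr.2.1 h (hπ 0)
      · exact ⟨_, hq, hr.1 _⟩
      · exact ⟨q, hq, hrq⟩
    obtain ⟨s₀, hs₀, hrs₀⟩ := hzero
    choose next hnext using fun (i : ℕ) (s : {s // s ∈ B i ∧ r (π i) s}) =>
      exists_next_prunedSeq hr hmono (hstep i) s.2.1 s.2.2
    let σ : ∀ i, {s // s ∈ B i ∧ r (π i) s} := fun i =>
      Nat.rec ⟨s₀, hs₀, hrs₀⟩ (fun i s => ⟨next i s, (hnext i s).1, (hnext i s).2.1⟩) i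
    have hmonoσ : Monotone fun i => h (σ i).1 :=
      monotone_nat_of_le_succ fun i => (hnext i (σ i)).2.2.1
    have hbdd : BddAbove (Set.range fun i => h (σ i).1) :=
      (Set.finite_range h).bddAbove.mono (Set.range_comp_subset_range (fun i => (σ i).1) h)
    obtain ⟨k, hk⟩ := hmonoσ.exists_forall_ge_eq_of_bddAbove hbdd
    have hσ : ∀ i ≥ k, ((σ i).1, w i, (σ (i + 1)).1) ∈ M.delta ∧
        ((π i, w i, π (i + 1)) ∈ M.F → ((σ i).1, w i, (σ (i + 1)).1) ∈ M.F) := fun i hi =>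
      (hnext i (σ i)).2.2.2 ((hk i hi).trans (hk (i + 1) (by omega)).symm)
    obtain ⟨f, hfk, hfmem, hfstep⟩ := exists_prefix_prunedSeq M _ w k _ (σ k).2.1
    have hge : ∀ i ≥ k, (if i ≤ k then f i else (σ i).1) = (σ i).1 := by
      intro i hi
      split_ifs with hik
      · obtain rfl := le_antisymm hik hi
        exact hfk
      · rfl
    refine ⟨fun i => if i ≤ k then f i else (σ i).1, fun i => ?_, fun i => ?_, ?_⟩
    · dsimp only
      split_ifs with hik
      · exact hfmem i hik
      · exact (σ i).2.1
    · dsimp only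
      rcases lt_or_ge i k with hlt | hle
      · rw [if_pos hlt.le, if_pos (Nat.succ_le_of_lt hlt)]
        exact hfstep i hlt
      · rw [hge i hle, hge (i + 1) (by omega)]
        exact (hσ i hle).1
    · refine (hinf.sdiff (Set.finite_lt_nat k)).mono ?_
      rintro i ⟨hi, hik⟩
      have hle : k ≤ i := not_lt.mp hik
      simp only [Set.mem_ofPred_eq]
      rw [hge i hle, hge (i + 1) (by omega)]
      exact (hσ i hle).2 hi
  · rintro ⟨π, hπ, hrest⟩
    exact ⟨π, fun i => prunedSeq_subset_subsetSeq M _ w i (hπ i), hrest⟩
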